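/- Let y ∈ ℝ^{m×n} be a fixed point of the perturbed map T̃, where T̃_{kj}(y) = min{ y_{kj} − h(y_k), −A_{kj}(y)·e^{h(y_k)} }. Then for every good k, exactly one of the following holds: (i) h(y_k) = 0 and y_{kj} + A_{kj}(y) ≤ 0 for every agent j; or (ii) h(y_k) < 0 and for every agent j, y_{kj} < 0 and e^{−h(y_k)} = −A_{kj}(y)/y_{kj}. -/

import Mathlib

/-- Max of a row: `h(z) = max_r z_r` (realized as `sSup` of the finite range). -/
noncomputable def rowMax {n : ℕ} (z : Fin n → ℝ) : ℝ := sSup (Set.range z)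

/-- The continuous-extension upper bound `g(x,λ)` from the paper. -/
noncomputable def gfun {m n : ℕ} (v x : Fin m → Fin n → ℝ) (lam : ℝ) : ℝ :=
  (1 / lam) * Real.log
    (∑ p ∈ Finset.univ.filter (fun p : Fin n × Fin n => p.1 ≠ p.2),
      ∑ k : Fin m, x k p.2 *
        ∏ ℓ ∈ Finset.univ.erase k,
          (1 - x ℓ p.1 - x ℓ p.2 + x ℓ p.1 * Real.exp (-lam * v ℓ p.1)
            + x ℓ p.2 * Real.exp (lam * v ℓ p.1)))

/-- `X` is an EFX allocation: a partition of the goods such that for all agents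
`i, j` and every good `k ∈ X_j`, `Σ_{ℓ∈X_i} v_{ℓi} ≥ Σ_{ℓ∈X_j} v_{ℓi} − v_{ki}`. -/
def IsEFX {m n : ℕ} (v : Fin m → Fin n → ℝ) (X : Fin n → Finset (Fin m)) : Prop :=
  (∀ i j, i ≠ j → Disjoint (X i) (X j)) ∧
  (Finset.univ.biUnion X = (Finset.univ : Finset (Fin m))) ∧
  (∀ i j : Fin n, ∀ k ∈ X j, (∑ ℓ ∈ X i, v ℓ i) ≥ (∑ ℓ ∈ X j, v ℓ i) - v k i)

/-- `A_{kj}(y) = max_{i≠j} Σ_{ℓ≠k} ( h(y_ℓ + v_{ℓi}(e_j − e_i)) − h(y_ℓ) )`. -/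
noncomputable def Amap {m n : ℕ} (v y : Fin m → Fin n → ℝ) (k : Fin m) (j : Fin n) : ℝ :=
  sSup { z : ℝ | ∃ i : Fin n, i ≠ j ∧
    z = ∑ ℓ ∈ Finset.univ.erase k,
      (rowMax (fun r => y ℓ r +
          v ℓ i * ((if r = j then (1 : ℝ) else 0) - (if r = i then (1 : ℝ) else 0)))
        - rowMax (y ℓ)) }

/-- The objective `f(y)` of Theorem `thm:f-y`; note that
`max{ y_{ℓi} − v_{ℓi}, y_{ℓj} + v_{ℓi}, max_{r∉{i,j}} y_{ℓr} }` is exactly the max of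
the row `y_ℓ + v_{ℓi}(e_j − e_i)` (and when `n = 2` the innermost max is absent). -/
noncomputable def fobj {m n : ℕ} (v y : Fin m → Fin n → ℝ) : ℝ :=
  sSup { z : ℝ | ∃ i j : Fin n, i ≠ j ∧ ∃ k : Fin m,
      z = y k j + ∑ ℓ ∈ Finset.univ.erase k,
        rowMax (fun r => y ℓ r +
          v ℓ i * ((if r = j then (1 : ℝ) else 0) - (if r = i then (1 : ℝ) else 0))) }
    - ∑ ℓ, rowMax (y ℓ)

theorem le_rowMax {n : ℕ} (z : Fin n → ℝ) (j : Fin n) : z j ≤ rowMax z :=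
  le_csSup (Set.finite_range z).bddAbove (Set.mem_range_self j)

/-- Let `y ∈ ℝ^{m×n}` be a fixed point of the perturbed map `T̃`,
where `T̃_{kj}(y) = min{ y_{kj} − h(y_k), −A_{kj}(y)·e^{h(y_k)} }`. Then for every
good `k`, exactly one of the following holds:
(i) `h(y_k) = 0` and `y_{kj} + A_{kj}(y) ≤ 0` for every agent `j`; or
(ii) `h(y_k) < 0` and for every agent `j`, `y_{kj} < 0` and
`e^{−h(y_k)} = −A_{kj}(y)/y_{kj}`. -/
theorem stmt_19 (m n : ℕ) (hm : 1 ≤ m) (hn : 2 ≤ n)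
    (v : Fin m → Fin n → ℝ) (hv : ∀ k i, 0 ≤ v k i)
    (y : Fin m → Fin n → ℝ)
    (hfix : (fun (k : Fin m) (j : Fin n) =>
      min (y k j - rowMax (y k)) (-(Amap v y k j) * Real.exp (rowMax (y k)))) = y) :
    ∀ k : Fin m,
      Xor'
        (rowMax (y k) = 0 ∧ ∀ j, y k j + Amap v y k j ≤ 0)
        (rowMax (y k) < 0 ∧ ∀ j, y k j < 0 ∧
          Real.exp (-(rowMax (y k))) = -(Amap v y k j) / y k j) := by
  intro k
  have fixed (j : Fin n) :
      min (y k j - rowMax (y k)) (-(Amap v y k j) * Real.exp (rowMax (y k))) = y k j :=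
    congrFun (congrFun hfix k) j
  have nonpos : rowMax (y k) ≤ 0 := by
    have := (fixed ⟨0, by omega⟩).symm.le.trans (min_le_left _ _)
    linarith
  rcases nonpos.eq_or_lt with h | h
  · refine Or.inl ⟨⟨h, fun j => ?_⟩, fun hlt => hlt.1.ne h⟩
    have := (fixed j).symm.le.trans (min_le_right _ _)
    rw [h, Real.exp_zero] at this
    linarith
  · refine Or.inr ⟨⟨h, fun j => ?_⟩, fun heq => h.ne heq.1⟩
    have hy : y k j < 0 := (le_rowMax (y k) j).trans_lt h
    refine ⟨hy, ?_⟩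
    have hA : -(Amap v y k j) * Real.exp (rowMax (y k)) = y k j := by
      rcases min_choice (y k j - rowMax (y k))
        (-(Amap v y k j) * Real.exp (rowMax (y k))) with hc | hc
      · linarith [fixed j]
      · exact hc.symm.trans (fixed j)
    rw [eq_div_iff hy.ne, ← hA, mul_left_comm, ← Real.exp_add, neg_add_cancel,
      Real.exp_zero, mul_one]
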